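/- arXiv:2003.06275 — 3 statements merged into one kernel-verified Lean document; each statement's English description precedes it below -/
import Mathlib

section
/- Let q be an odd prime power and F = F_q. The subspace W₁₁ = {[[0,b,c],[b,a,a],[c,a,a+c]] : a,b,c ∈ F} of Sym₃(F) (a representative of the orbit Σ₁₁) has point-orbit distribution [1, q, 0, q²]. -/
open Matrix

/-- The number of points (1-dimensional subspaces) contained in a set `S` of `3 × 3`
matrices whose (nonzero) spanning matrices satisfy the property `P`. -/
noncomputable def ptsWith (F : Type*) [Field F] (S : Set (Matrix (Fin 3) (Fin 3) F))
    (P : Matrix (Fin 3) (Fin 3) F → Prop) : ℕ :=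
  Set.ncard {p : Submodule F (Matrix (Fin 3) (Fin 3) F) |
    ↑p ⊆ S ∧ Module.finrank F ↥p = 1 ∧ ∃ M ∈ p, M ≠ 0 ∧ P M}

/-- A matrix is exterior if it is congruent to `diag(1, −1, 0)`. -/
def Exterior {F : Type*} [Field F] (M : Matrix (Fin 3) (Fin 3) F) : Prop :=
  ∃ A : Matrix (Fin 3) (Fin 3) F, IsUnit A ∧ A * M * Aᵀ = diagonal ![1, -1, 0]

/-- A matrix is interior if it is congruent to `diag(1, −ε, 0)` for some nonsquare `ε`. -/
def Interior {F : Type*} [Field F] (M : Matrix (Fin 3) (Fin 3) F) : Prop :=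
  ∃ (A : Matrix (Fin 3) (Fin 3) F) (ε : F), IsUnit A ∧ ¬ IsSquare ε ∧
    A * M * Aᵀ = diagonal ![1, -ε, 0]

/-- `S` has point-orbit distribution `[n₁, n₂, n₃, n₄]`: it contains `n₁` rank-1 points,
`n₂` exterior rank-2 points, `n₃` interior rank-2 points and `n₄` rank-3 points. -/
def HasPointOrbitDistribution (F : Type*) [Field F] (S : Set (Matrix (Fin 3) (Fin 3) F))
    (n₁ n₂ n₃ n₄ : ℕ) : Prop :=
  ptsWith F S (fun M => M.rank = 1) = n₁ ∧
  ptsWith F S Exterior = n₂ ∧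
  ptsWith F S Interior = n₃ ∧
  ptsWith F S (fun M => M.rank = 3) = n₄

/-- The matrix of `Σ₁₁` with parameters `a`, `b`, `c`. -/
def sigmaMatrix {F : Type*} [Field F] (a b c : F) : Matrix (Fin 3) (Fin 3) F :=
  !![0, b, c; b, a, a; c, a, a + c]

section

variable {F : Type*} [Field F]

/-- Points of `S` satisfying `P` are counted by a system of normalised representatives. -/
theorem ptsWith_eq_card {S : Set (Matrix (Fin 3) (Fin 3) F)}
    {P : Matrix (Fin 3) (Fin 3) F → Prop} {α : Type*} (f : α → Matrix (Fin 3) (Fin 3) F)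
    (hS : ∀ (r : F) (x : α), r • f x ∈ S) (h0 : ∀ x, f x ≠ 0) (hP : ∀ x, P (f x))
    (hinj : ∀ (x y : α) (r : F), r • f x = f y → x = y)
    (hsurj : ∀ M ∈ S, M ≠ 0 → P M → ∃ (x : α) (r : F), M = r • f x) :
    ptsWith F S P = Nat.card α := by
  have key : {p : Submodule F (Matrix (Fin 3) (Fin 3) F) |
      ↑p ⊆ S ∧ Module.finrank F ↥p = 1 ∧ ∃ M ∈ p, M ≠ 0 ∧ P M} =
      Set.range fun x => Submodule.span F {f x} := by
    ext p
    constructor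
    · rintro ⟨hpS, hp, M, hM, hM0, hPM⟩
      obtain ⟨x, r, rfl⟩ := hsurj M (hpS hM) hM0 hPM
      have hr : r ≠ 0 := fun h => hM0 (by simp [h])
      have hx : f x ∈ p := (Submodule.smul_mem_iff p hr).1 hM
      have : Module.Finite F p := Module.finite_of_finrank_eq_succ hp
      refine ⟨x, Submodule.eq_of_le_of_finrank_eq ?_ ?_⟩
      · rwa [Submodule.span_singleton_le_iff_mem]
      · rw [hp, finrank_span_singleton (h0 x)]
    · rintro ⟨x, rfl⟩
      refine ⟨fun M hM => ?_, finrank_span_singleton (h0 x), f x,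
        Submodule.mem_span_singleton_self _, h0 x, hP x⟩
      obtain ⟨r, rfl⟩ := Submodule.mem_span_singleton.1 hM
      exact hS r x
  rw [ptsWith, key, Set.ncard_def, ← Set.image_univ, Set.InjOn.encard_image, Set.encard_univ]
  · rfl
  · intro x _ y _ hxy
    have : f y ∈ Submodule.span F {f x} := by
      rw [show Submodule.span F {f x} = Submodule.span F {f y} from hxy]
      exact Submodule.mem_span_singleton_self _
    obtain ⟨r, hr⟩ := Submodule.mem_span_singleton.1 this
    exact hinj x y r hr

theorem rank_eq_three_iff_det_ne_zero (M : Matrix (Fin 3) (Fin 3) F) :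
    M.rank = 3 ↔ M.det ≠ 0 := by
  rw [← isUnit_iff_ne_zero, ← isUnit_iff_isUnit_det, ← linearIndependent_cols_iff_isUnit,
    linearIndependent_iff_card_eq_finrank_span, rank_eq_finrank_span_cols]
  simp [Set.finrank, eq_comm]

theorem smul_sigmaMatrix (r a b c : F) :
    r • sigmaMatrix a b c = sigmaMatrix (r * a) (r * b) (r * c) := by
  ext i j
  fin_cases i <;> fin_cases j <;> simp [sigmaMatrix, mul_add]

theorem sigmaMatrix_inj {a b c a' b' c' : F} :
    sigmaMatrix a b c = sigmaMatrix a' b' c' ↔ a = a' ∧ b = b' ∧ c = c' := by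
  constructor
  · intro h
    refine ⟨?_, ?_, ?_⟩
    · simpa [sigmaMatrix] using congrFun₂ h 1 1
    · simpa [sigmaMatrix] using congrFun₂ h 0 1
    · simpa [sigmaMatrix] using congrFun₂ h 0 2
  · rintro ⟨rfl, rfl, rfl⟩
    rfl

theorem sigmaMatrix_ne_zero {a b c : F} (h : a ≠ 0 ∨ b ≠ 0 ∨ c ≠ 0) :
    sigmaMatrix a b c ≠ 0 := by
  have h0 : (0 : Matrix (Fin 3) (Fin 3) F) = sigmaMatrix 0 0 0 := by
    simpa using smul_sigmaMatrix (0 : F) 0 0 0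
  rw [h0, Ne, sigmaMatrix_inj]
  tauto

theorem det_sigmaMatrix (a b c : F) :
    (sigmaMatrix a b c).det = -(a * (b - c) ^ 2 + b ^ 2 * c) := by
  simp [sigmaMatrix, det_fin_three]
  ring

theorem eq_zero_of_rank_sigmaMatrix_eq_one {a b c : F} (h : (sigmaMatrix a b c).rank = 1) :
    b = 0 ∧ c = 0 := by
  have minor (k : Fin 3) : ((sigmaMatrix a b c).submatrix ![0, k] ![0, k]).det = 0 := by
    by_contra hd
    have h1 := rank_submatrix_le (sigmaMatrix a b c) ![0, k] ![0, k]
    rw [rank_of_isUnit _ ((isUnit_iff_isUnit_det _).2 (isUnit_iff_ne_zero.2 hd)), h] at h1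
    simp at h1
  have h1 := minor 1
  have h2 := minor 2
  rw [det_fin_two] at h1 h2
  simp [sigmaMatrix] at h1 h2
  exact ⟨h1, h2⟩

theorem rank_sigmaMatrix_one_zero_zero : (sigmaMatrix (1 : F) 0 0).rank = 1 := by
  apply le_antisymm
  · have h : sigmaMatrix (1 : F) 0 0 = vecMulVec ![0, 1, 1] ![0, 1, 1] := by
      ext i j
      fin_cases i <;> fin_cases j <;> simp [sigmaMatrix, vecMulVec_apply]
    rw [h]
    exact rank_vecMulVec_le _ _
  · have h := rank_submatrix_le (sigmaMatrix (1 : F) 0 0) ![1] ![1]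
    rwa [rank_of_isUnit, Fintype.card_fin] at h
    rw [isUnit_iff_isUnit_det, det_fin_one]
    simp [sigmaMatrix]

theorem det_eq_zero_of_congruent {A M : Matrix (Fin 3) (Fin 3) F} {ε : F} (hA : IsUnit A)
    (h : A * M * Aᵀ = diagonal ![1, -ε, 0]) : M.det = 0 := by
  have hd := congrArg det h
  have hA' : A.det ≠ 0 := isUnit_iff_ne_zero.1 ((isUnit_iff_isUnit_det A).1 hA)
  simpa [det_mul, det_transpose, det_diagonal, Fin.prod_univ_three, hA'] using hd

theorem eq_zero_of_sigmaMatrix_congruent {A : Matrix (Fin 3) (Fin 3) F} {a ε : F}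
    (h : A * sigmaMatrix a 0 0 * Aᵀ = diagonal ![1, -ε, 0]) : ε = 0 := by
  have h00 := congrFun₂ h 0 0
  have h01 := congrFun₂ h 0 1
  have h11 := congrFun₂ h 1 1
  simp [sigmaMatrix, mul_apply, Fin.sum_univ_three] at h00 h01 h11
  grind

theorem not_interior_sigmaMatrix (a b c : F) : ¬ Interior (sigmaMatrix a b c) := by
  rintro ⟨A, ε, hA, hε, h⟩
  obtain ⟨B, hBA⟩ := hA.exists_left_inv
  have hM : sigmaMatrix a b c = B * diagonal ![1, -ε, 0] * Bᵀ := by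
    have hT : Aᵀ * Bᵀ = 1 := by rw [← transpose_mul, hBA, transpose_one]
    rw [← h, ← mul_assoc, ← mul_assoc, hBA, one_mul, mul_assoc, hT, mul_one]
  have h00 := congrFun₂ hM 0 0
  have h01 := congrFun₂ hM 0 1
  have h02 := congrFun₂ hM 0 2
  simp [sigmaMatrix, mul_apply, Fin.sum_univ_three, diagonal_apply] at h00 h01 h02
  have hB1 : B 0 1 = 0 := by
    by_contra hB
    refine hε ⟨B 0 0 / B 0 1, ?_⟩
    field_simp
    linear_combination h00
  have hB0 : B 0 0 = 0 := by simpa [hB1] using h00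
  have hb : b = 0 := by simpa [hB0, hB1] using h01
  have hc : c = 0 := by simpa [hB0, hB1] using h02
  subst hb hc
  exact hε (by simp [eq_zero_of_sigmaMatrix_congruent h])

/-- The rank-2 points of `Σ₁₁`, normalised by `b - c = 1`. -/
theorem exterior_sigmaMatrix (h2 : (2 : F) ≠ 0) (t : F) :
    Exterior (sigmaMatrix (-(t ^ 2 * (t - 1))) t (t - 1)) := by
  rcases eq_or_ne t 0 with rfl | ht
  · refine ⟨!![1, 0, -1; 0, 0, 1; 0, 1, 0], ?_, ?_⟩
    · rw [isUnit_iff_isUnit_det]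
      simp [det_fin_three]
    · ext i j
      fin_cases i <;> fin_cases j <;>
        simp [sigmaMatrix, mul_apply, Fin.sum_univ_three]
  · refine ⟨!![t / 2, 1 / t, 0; 1 - t / 2, -(1 / t), 0; -(t * (t - 1)), t - 1, -t], ?_, ?_⟩
    · rw [isUnit_iff_isUnit_det, isUnit_iff_ne_zero]
      have : det !![t / 2, 1 / t, 0; 1 - t / 2, -(1 / t), 0; -(t * (t - 1)), t - 1, -t] = 1 := by
        simp [det_fin_three]
        field_simp
        ring
      rw [this]
      exact one_ne_zero
    · ext i j
      fin_cases i <;> fin_cases j <;>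
        simp [sigmaMatrix, mul_apply, Fin.sum_univ_three] <;> field_simp <;> ring

theorem sub_ne_zero_of_exterior {a b c : F} (h : Exterior (sigmaMatrix a b c)) : b - c ≠ 0 := by
  obtain ⟨A, hA, h⟩ := h
  intro hbc
  obtain rfl : b = c := sub_eq_zero.1 hbc
  have hd := det_eq_zero_of_congruent (ε := 1) hA h
  rw [det_sigmaMatrix] at hd
  obtain rfl : b = 0 := by
    have : b ^ 3 = 0 := by linear_combination -hd
    exact pow_eq_zero_iff (by norm_num) |>.1 this
  exact one_ne_zero (eq_zero_of_sigmaMatrix_congruent (ε := 1) h)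

open Classical in
/-- The rank-3 points of `Σ₁₁`: those with `b ≠ c`, normalised by `b - c = 1`, and those with
`b = c`, normalised by `b = 1`. -/
noncomputable def rankThreePoint (x : F × F) : Matrix (Fin 3) (Fin 3) F :=
  if x.1 = 0 then sigmaMatrix x.2 1 1
  else sigmaMatrix (x.1 - x.2 ^ 2 * (x.2 - 1)) x.2 (x.2 - 1)

theorem det_rankThreePoint_ne_zero (x : F × F) : (rankThreePoint x).det ≠ 0 := by
  unfold rankThreePoint
  split_ifs with h
  · simp [det_sigmaMatrix]
  · rw [det_sigmaMatrix]
    ring_nf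
    simpa using h

theorem rankThreePoint_injective_up_to_smul (x y : F × F) (r : F)
    (h : r • rankThreePoint x = rankThreePoint y) : x = y := by
  obtain ⟨s, t⟩ := x
  obtain ⟨s', t'⟩ := y
  unfold rankThreePoint at h
  split_ifs at h with h1 h2 h2 <;> rw [smul_sigmaMatrix, sigmaMatrix_inj] at h <;>
    obtain ⟨ha, hb, hc⟩ := h <;> simp only at h1 h2 ha hb hc <;> grind

theorem exists_smul_rankThreePoint {a b c : F} (h : (sigmaMatrix a b c).det ≠ 0) :
    ∃ (x : F × F) (r : F), sigmaMatrix a b c = r • rankThreePoint x := by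
  rw [det_sigmaMatrix] at h
  by_cases hbc : b - c = 0
  · obtain rfl : b = c := sub_eq_zero.1 hbc
    have hb : b ≠ 0 := by
      rintro rfl
      simp at h
    refine ⟨(0, a / b), b, ?_⟩
    rw [rankThreePoint, if_pos rfl, smul_sigmaMatrix, sigmaMatrix_inj]
    refine ⟨?_, ?_, ?_⟩ <;> field_simp
  · refine ⟨((a * (b - c) ^ 2 + b ^ 2 * c) / (b - c) ^ 3, b / (b - c)), b - c, ?_⟩
    rw [rankThreePoint, if_neg, smul_sigmaMatrix, sigmaMatrix_inj]
    · refine ⟨?_, ?_, ?_⟩ <;> field_simp <;> ring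
    · exact div_ne_zero (neg_ne_zero.1 h) (pow_ne_zero _ hbc)

end

/-- The plane `Σ₁₁` representative has point-orbit distribution `[1, q, 0, q²]`. -/
theorem distribution_Sigma11 (F : Type*) [Field F] [Fintype F]
    (hodd : Odd (Fintype.card F)) :
    HasPointOrbitDistribution F
      {M | ∃ a b c : F, M = !![0, b, c; b, a, a; c, a, a + c]}
      1
      (Fintype.card F)
      0
      (Fintype.card F ^ 2) := by
  have h2 : (2 : F) ≠ 0 := Ring.two_ne_zero fun h => by
    have := FiniteField.even_card_of_char_two h
    grind
  refine ⟨?_, ?_, ?_, ?_⟩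
  · rw [ptsWith_eq_card fun _ : Unit => sigmaMatrix (1 : F) 0 0]
    · simp
    · exact fun r _ => ⟨_, _, _, smul_sigmaMatrix r 1 0 0⟩
    · exact fun _ => sigmaMatrix_ne_zero (by simp)
    · exact fun _ => rank_sigmaMatrix_one_zero_zero
    · exact fun _ _ _ _ => rfl
    · rintro _ ⟨a, b, c, rfl⟩ _ h
      obtain ⟨rfl, rfl⟩ := eq_zero_of_rank_sigmaMatrix_eq_one h
      refine ⟨(), a, ?_⟩
      rw [smul_sigmaMatrix]
      simp [sigmaMatrix]
  · rw [ptsWith_eq_card fun t : F => sigmaMatrix (-(t ^ 2 * (t - 1))) t (t - 1)]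
    · simp
    · exact fun r _ => ⟨_, _, _, smul_sigmaMatrix r _ _ _⟩
    · exact fun t => sigmaMatrix_ne_zero (by grind)
    · exact exterior_sigmaMatrix h2
    · intro t t' r h
      rw [smul_sigmaMatrix, sigmaMatrix_inj] at h
      grind
    · rintro _ ⟨a, b, c, rfl⟩ _ h
      have hbc := sub_ne_zero_of_exterior h
      obtain ⟨A, hA, h⟩ := h
      have hd := det_eq_zero_of_congruent (ε := 1) hA h
      rw [← sigmaMatrix, det_sigmaMatrix] at hd
      refine ⟨b / (b - c), b - c, ?_⟩
      rw [← sigmaMatrix, smul_sigmaMatrix, sigmaMatrix_inj]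
      refine ⟨?_, ?_, ?_⟩ <;> field_simp
      · linear_combination -hd
      · ring
  · rw [ptsWith_eq_card (α := Empty) fun x => x.elim]
    · simp
    iterate 4 exact fun x => nofun
    rintro _ ⟨a, b, c, rfl⟩ _ h
    exact (not_interior_sigmaMatrix a b c h).elim
  · rw [ptsWith_eq_card (rankThreePoint (F := F))]
    · simp [sq]
    · intro r x
      unfold rankThreePoint
      split_ifs <;> exact ⟨_, _, _, smul_sigmaMatrix r _ _ _⟩
    · intro x h
      exact det_rankThreePoint_ne_zero x (by simp [h])
    · exact fun x => (rank_eq_three_iff_det_ne_zero _).2 (det_rankThreePoint_ne_zero x)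
    · exact rankThreePoint_injective_up_to_smul
    · rintro _ ⟨a, b, c, rfl⟩ _ h
      exact exists_smul_rankThreePoint ((rank_eq_three_iff_det_ne_zero _).1 h)
end

section
/- Let q be an odd prime power, F = F_q, and let ε ∈ F be a nonsquare. Let W₁₂ = {[[a,b,0],[b,c,b],[0,b,c]] : a,b,c ∈ F} and W₁₃ = {[[a,b,0],[b,c,b],[0,b,εc]] : a,b,c ∈ F} be subspaces of Sym₃(F) (representatives of the orbits Σ₁₂ and Σ₁₃). Then W₁₂ has point-orbit distribution [1, (q−1)/2, (q−1)/2, q²+1] and W₁₃ has point-orbit distribution [1, (q+1)/2, (q+1)/2, q²−1]. -/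
open Matrix

/-- The symmetric matrix with parameters `a, b, c` in the plane attached to `δ`. -/
def planeMat {F : Type*} [Field F] (δ a b c : F) : Matrix (Fin 3) (Fin 3) F :=
  !![a, b, 0; b, c, b; 0, b, δ * c]

/-- Normalised representatives of the points of the projective plane attached to `δ`. -/
def planePt {F : Type*} [Field F] (δ : F) : Unit ⊕ F ⊕ F × F → Matrix (Fin 3) (Fin 3) F
  | .inl _ => planeMat δ 1 0 0
  | .inr (.inl a) => planeMat δ a 1 0
  | .inr (.inr (b, a)) => planeMat δ a b 1

section
variable {F : Type*} [Field F]

theorem smul_planeMat (t δ a b c : F) :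
    t • planeMat δ a b c = planeMat δ (t * a) (t * b) (t * c) := by
  simp [planeMat, smul_of, mul_left_comm]

theorem planeMat_inj {δ a b c a' b' c' : F} :
    planeMat δ a b c = planeMat δ a' b' c' ↔ a = a' ∧ b = b' ∧ c = c' := by
  refine ⟨fun h => ⟨?_, ?_, ?_⟩, by rintro ⟨rfl, rfl, rfl⟩; rfl⟩
  · simpa [planeMat] using congr_fun₂ h 0 0
  · simpa [planeMat] using congr_fun₂ h 0 1
  · simpa [planeMat] using congr_fun₂ h 1 1

theorem planeMat_zero (δ : F) : planeMat δ 0 0 0 = 0 := by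
  simpa using (smul_planeMat 0 δ 0 0 0).symm

theorem det_planeMat (δ a b c : F) :
    (planeMat δ a b c).det = a * (δ * c ^ 2 - b ^ 2) - δ * b ^ 2 * c := by
  simp [planeMat, det_fin_three]; ring

theorem planePt_ne_zero (δ : F) (n) : planePt δ n ≠ 0 := by
  rw [← planeMat_zero δ]
  rcases n with _ | a | ⟨b, a⟩ <;> simp [planePt, planeMat_inj]

theorem exists_smul_planePt {δ a b c : F} (h : planeMat δ a b c ≠ 0) :
    ∃ n, ∃ t : F, t ≠ 0 ∧ planeMat δ a b c = t • planePt δ n := by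
  by_cases hc : c = 0
  · by_cases hb : b = 0
    · have ha : a ≠ 0 := by rintro rfl; simp [hb, hc, planeMat_zero] at h
      exact ⟨.inl (), a, ha, by simp [planePt, smul_planeMat, hb, hc]⟩
    · exact ⟨.inr (.inl (a / b)), b, hb, by
        simp [planePt, smul_planeMat, hc, mul_div_cancel₀ _ hb]⟩
  · exact ⟨.inr (.inr (b / c, a / c)), c, hc, by
      simp [planePt, smul_planeMat, mul_div_cancel₀ _ hc]⟩

theorem smul_planePt_inj {δ t : F} {m n} (h : t • planePt δ m = planePt δ n) : m = n := by
  rcases m with _ | a | ⟨b, a⟩ <;> rcases n with _ | a' | ⟨b', a'⟩ <;>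
    simp [planePt, smul_planeMat, planeMat_inj] at h ⊢ <;> grind

theorem ptsWith_plane_eq_ncard (δ : F) {P : Matrix (Fin 3) (Fin 3) F → Prop}
    (hP : ∀ n (t : F), t ≠ 0 → P (t • planePt δ n) → P (planePt δ n)) :
    ptsWith F {M | ∃ a b c, M = planeMat δ a b c} P = {n | P (planePt δ n)}.ncard := by
  have hinj : Function.Injective fun n => Submodule.span F {planePt δ n} := by
    intro m n h
    have hn : planePt δ n ∈ Submodule.span F {planePt δ m} := by
      simp only at h
      rw [h]
      exact Submodule.mem_span_singleton_self _
    obtain ⟨t, ht⟩ := Submodule.mem_span_singleton.1 hn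
    exact smul_planePt_inj ht
  rw [ptsWith, ← Set.ncard_image_of_injective _ hinj]
  congr 1
  ext p
  constructor
  · rintro ⟨hp, hrank, M, hM, hM0, hPM⟩
    obtain ⟨a, b, c, rfl⟩ := hp hM
    obtain ⟨n, t, ht, hMt⟩ := exists_smul_planePt hM0
    refine ⟨n, hP n t ht (hMt ▸ hPM), ?_⟩
    rw [hMt] at hM
    have hn : planePt δ n ∈ p := (p.smul_mem_iff ht).1 hM
    have : FiniteDimensional F p := Module.finite_of_finrank_eq_succ hrank
    refine Submodule.eq_of_le_of_finrank_eq ?_ ?_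
    · simpa [Submodule.span_le] using hn
    · rw [hrank, finrank_span_singleton (planePt_ne_zero δ n)]
  · rintro ⟨n, hn, rfl⟩
    refine ⟨?_, finrank_span_singleton (planePt_ne_zero δ n), _,
      Submodule.mem_span_singleton_self _, planePt_ne_zero δ n, hn⟩
    intro M hM
    obtain ⟨t, rfl⟩ := Submodule.mem_span_singleton.1 hM
    rcases n with _ | a | ⟨b, a⟩ <;> exact ⟨_, _, _, smul_planeMat ..⟩

open Classical in
theorem ptsWith_plane [Fintype F] (δ : F) {P : Matrix (Fin 3) (Fin 3) F → Prop}
    (hP : ∀ n (t : F), t ≠ 0 → P (t • planePt δ n) → P (planePt δ n)) :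
    ptsWith F {M | ∃ a b c, M = planeMat δ a b c} P =
      (if P (planeMat δ 1 0 0) then 1 else 0) + ((∑ a, if P (planeMat δ a 1 0) then 1 else 0) +
        ∑ b, ∑ a, if P (planeMat δ a b 1) then 1 else 0) := by
  rw [ptsWith_plane_eq_ncard δ hP, Set.ncard_eq_toFinset_card', Set.toFinset_ofPred,
    Finset.card_filter, Fintype.sum_sum_type, Fintype.sum_sum_type, Fintype.sum_prod_type]
  simp only [planePt, Finset.univ_unique, Finset.sum_singleton]
  congr!

theorem rank_eq_three_iff {M : Matrix (Fin 3) (Fin 3) F} : M.rank = 3 ↔ M.det ≠ 0 := by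
  rw [← isUnit_iff_ne_zero, ← isUnit_iff_isUnit_det, ← linearIndependent_rows_iff_isUnit,
    linearIndependent_iff_card_eq_finrank_span, rank_eq_finrank_span_row, eq_comm]
  simp [Set.finrank]

theorem two_le_rank {M : Matrix (Fin 3) (Fin 3) F} (r c : Fin 2 → Fin 3)
    (h : M (r 0) (c 0) * M (r 1) (c 1) - M (r 0) (c 1) * M (r 1) (c 0) ≠ 0) : 2 ≤ M.rank := by
  have h1 := rank_of_det_ne_zero (A := M.submatrix r c) (by simpa [det_fin_two] using h)
  have h2 := rank_submatrix_le M r c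
  simp at h1
  omega

theorem rank_planeMat_left {δ a : F} (ha : a ≠ 0) : (planeMat δ a 0 0).rank = 1 := by
  classical
  have : planeMat δ a 0 0 = diagonal ![a, 0, 0] := by
    ext i j; fin_cases i <;> fin_cases j <;> simp [planeMat]
  rw [this, rank_diagonal, Fintype.card_eq_one_iff]
  refine ⟨⟨0, by simpa⟩, ?_⟩
  rintro ⟨i, hi⟩
  fin_cases i
  · rfl
  · simp at hi
  · simp at hi

theorem rank_planeMat_eq_one_iff {δ : F} (hδ : δ ≠ 0) {a b c : F} :
    (planeMat δ a b c).rank = 1 ↔ a ≠ 0 ∧ b = 0 ∧ c = 0 := by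
  constructor
  · intro h
    have hb : b = 0 := by
      by_contra hb
      have := two_le_rank (M := planeMat δ a b c) ![0, 1] ![1, 2] (by simpa [planeMat])
      omega
    have hc : c = 0 := by
      by_contra hc
      have := two_le_rank (M := planeMat δ a b c) ![1, 2] ![1, 2] (by simp [planeMat, hb, hc, hδ])
      omega
    refine ⟨?_, hb, hc⟩
    rintro rfl
    simp [hb, hc, planeMat_zero] at h
  · rintro ⟨ha, rfl, rfl⟩
    exact rank_planeMat_left ha

theorem exists_of_congr_diagonal {M A : Matrix (Fin 3) (Fin 3) F} {e : F} (hA : IsUnit A)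
    (h : A * M * Aᵀ = diagonal ![1, -e, 0]) :
    ∃ x y : Fin 3 → F, ∀ i j, M i j = x i * x j - e * (y i * y j) := by
  obtain ⟨u, rfl⟩ := hA
  have hM : M = (u⁻¹).val * diagonal ![1, -e, 0] * ((u⁻¹).val)ᵀ := by
    have h1 : ((u : Matrix (Fin 3) (Fin 3) F))ᵀ * ((u⁻¹).val)ᵀ = 1 := by
      rw [← transpose_mul]; simp
    rw [← h]
    simp only [Matrix.mul_assoc, h1]
    simp
  refine ⟨fun i => (u⁻¹).val i 0, fun i => (u⁻¹).val i 1, fun i j => ?_⟩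
  conv_lhs => rw [hM]
  simp [mul_apply, Fin.sum_univ_three, diagonal_apply]
  ring

theorem two_le_rank_of_congr_diagonal {M A : Matrix (Fin 3) (Fin 3) F} {e : F} (he : e ≠ 0)
    (h : A * M * Aᵀ = diagonal ![1, -e, 0]) : 2 ≤ M.rank := by
  calc 2 ≤ (A * M * Aᵀ).rank := by
        rw [h]; exact two_le_rank ![0, 1] ![0, 1] (by simpa)
    _ ≤ (A * M).rank := rank_mul_le_left _ _
    _ ≤ M.rank := rank_mul_le_right _ _

/-- Necessary conditions for a matrix of the plane to be congruent to `diag(1, -e, 0)`. -/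
theorem planeMat_congr_diagonal {δ a b c e : F} {A : Matrix (Fin 3) (Fin 3) F} (he : e ≠ 0)
    (hA : IsUnit A) (h : A * planeMat δ a b c * Aᵀ = diagonal ![1, -e, 0]) :
    a * (δ * c ^ 2 - b ^ 2) = δ * b ^ 2 * c ∧ (b ≠ 0 ∨ c ≠ 0) ∧
      ∃ s, b ^ 2 - δ * c ^ 2 = e * s ^ 2 := by
  have hr := two_le_rank_of_congr_diagonal he h
  obtain ⟨x, y, hxy⟩ := exists_of_congr_diagonal hA h
  have h00 := hxy 0 0
  have h01 := hxy 0 1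
  have h02 := hxy 0 2
  have h11 := hxy 1 1
  have h12 := hxy 1 2
  have h22 := hxy 2 2
  simp [planeMat] at h00 h01 h02 h11 h12 h22
  refine ⟨?_, ?_, x 1 * y 2 - x 2 * y 1, ?_⟩
  · have hdet : (planeMat δ a b c).det = 0 := by
      rw [det_fin_three]; simp only [hxy]; ring
    rw [det_planeMat] at hdet
    linear_combination hdet
  · by_contra! hbc
    obtain ⟨rfl, rfl⟩ := hbc
    by_cases ha : a = 0
    · simp [ha, planeMat_zero] at hr
    · rw [rank_planeMat_left ha] at hr
      omega
  · have e1 : b ^ 2 - δ * c ^ 2 = b * b - c * (δ * c) := by ring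
    rw [e1, h22]
    nth_rw 1 2 [h12]
    rw [h11]
    ring

theorem planeMat_one_congr {δ a b s : F} (hs : s ≠ 0) (hm : δ - b ^ 2 ≠ 0)
    (ha : a * (δ - b ^ 2) = δ * b ^ 2) :
    ∃ A : Matrix (Fin 3) (Fin 3) F, IsUnit A ∧
      A * planeMat δ a b 1 * Aᵀ = diagonal ![1, (δ - b ^ 2) / s ^ 2, 0] := by
  obtain rfl : a = δ * b ^ 2 / (δ - b ^ 2) := by field_simp; exact ha
  refine ⟨!![0, 1, 0; 0, -b / s, 1 / s; 1, -b * δ / (δ - b ^ 2), b ^ 2 / (δ - b ^ 2)], ?_, ?_⟩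
  · rw [isUnit_iff_isUnit_det, isUnit_iff_ne_zero]
    simp [det_fin_three, hs]
  · ext i j
    fin_cases i <;> fin_cases j <;>
      simp [planeMat, mul_apply, Fin.sum_univ_three] <;> field_simp <;> ring

theorem exterior_planeMat_zero_one_zero (h2 : (2 : F) ≠ 0) (δ : F) :
    Exterior (planeMat δ 0 1 0) := by
  refine ⟨!![1 / 2, 1, 0; 1 / 2, -1, 0; 1, 0, -1], ?_, ?_⟩
  · rw [isUnit_iff_isUnit_det, isUnit_iff_ne_zero]
    simp [det_fin_three]; field_simp; norm_num [h2]
  · ext i j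
    fin_cases i <;> fin_cases j <;>
      simp [planeMat, mul_apply, Fin.sum_univ_three] <;> field_simp <;> norm_num
/-- Necessary conditions for `t • planePt δ n` to be congruent to `diag(1, -e, 0)`. -/
theorem smul_planePt_congr_diagonal {δ e t : F} (hδ : δ ≠ 0) (he : e ≠ 0) (ht : t ≠ 0) {n}
    {A : Matrix (Fin 3) (Fin 3) F} (hA : IsUnit A)
    (h : A * (t • planePt δ n) * Aᵀ = diagonal ![1, -e, 0]) :
    match n with
    | .inl _ => False
    | .inr (.inl a) => a = 0 ∧ IsSquare e
    | .inr (.inr (b, a)) => a * (δ - b ^ 2) = δ * b ^ 2 ∧ b ^ 2 ≠ δ ∧ ∃ s, b ^ 2 - δ = e * s ^ 2 := by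
  rcases n with _ | a | ⟨b, a⟩ <;> simp only [planePt, smul_planeMat] at h <;>
    obtain ⟨h1, h2, s, hs⟩ := planeMat_congr_diagonal he hA h
  · simp at h2
  · have hs0 : s ≠ 0 := by rintro rfl; simp [ht] at hs
    refine ⟨by simpa [ht] using h1, t / s, ?_⟩
    field_simp
    linear_combination -hs
  · have h1' : a * (δ - b ^ 2) = δ * b ^ 2 :=
      mul_left_cancel₀ (pow_ne_zero 3 ht) (by linear_combination h1)
    refine ⟨h1', ?_, s / t, ?_⟩
    · rintro hb
      simp [hb, hδ] at h1'
    · field_simp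
      linear_combination hs

theorem exterior_of_smul_planePt {δ t : F} (hδ : δ ≠ 0) (ht : t ≠ 0) {n}
    (h : Exterior (t • planePt δ n)) :
    match n with
    | .inl _ => False
    | .inr (.inl a) => a = 0
    | .inr (.inr (b, a)) => b ^ 2 ≠ δ ∧ IsSquare (b ^ 2 - δ) ∧ a = δ * b ^ 2 / (δ - b ^ 2) := by
  obtain ⟨A, hA, h⟩ := h
  have := smul_planePt_congr_diagonal hδ one_ne_zero ht hA h
  rcases n with _ | a | ⟨b, a⟩
  · exact this
  · exact this.1
  · obtain ⟨h1, h2, s, hs⟩ := this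
    exact ⟨h2, ⟨s, by rw [hs]; ring⟩, (eq_div_iff (sub_ne_zero.2 h2.symm)).2 h1⟩

theorem interior_of_smul_planePt {δ t : F} (hδ : δ ≠ 0) (ht : t ≠ 0) {n}
    (h : Interior (t • planePt δ n)) :
    match n with
    | .inl _ => False
    | .inr (.inl _) => False
    | .inr (.inr (b, a)) => ¬ IsSquare (b ^ 2 - δ) ∧ a = δ * b ^ 2 / (δ - b ^ 2) := by
  obtain ⟨A, e, hA, he, h⟩ := h
  have he0 : e ≠ 0 := by rintro rfl; simp at he
  have := smul_planePt_congr_diagonal hδ he0 ht hA h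
  rcases n with _ | a | ⟨b, a⟩
  · exact this
  · exact he this.2
  · obtain ⟨h1, h2, s, hs⟩ := this
    refine ⟨?_, (eq_div_iff (sub_ne_zero.2 h2.symm)).2 h1⟩
    rintro ⟨r, hr⟩
    have hs0 : s ≠ 0 := by
      rintro rfl
      simp [sub_eq_zero, h2] at hs
    refine he ⟨r / s, ?_⟩
    field_simp
    linear_combination hr - hs

theorem exterior_planeMat_one {δ a b : F} (hb : b ^ 2 ≠ δ) (hsq : IsSquare (b ^ 2 - δ))
    (ha : a = δ * b ^ 2 / (δ - b ^ 2)) : Exterior (planeMat δ a b 1) := by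
  obtain ⟨s, hs⟩ := hsq
  have hm : δ - b ^ 2 ≠ 0 := sub_ne_zero.2 hb.symm
  have hs0 : s ≠ 0 := by rintro rfl; simp [sub_eq_zero, hb] at hs
  obtain ⟨A, hA, h⟩ := planeMat_one_congr hs0 hm ((eq_div_iff hm).1 ha)
  have : (δ - b ^ 2) / s ^ 2 = -1 := by
    field_simp
    linear_combination -hs
  exact ⟨A, hA, this ▸ h⟩

theorem interior_planeMat_one {δ a b : F} (hsq : ¬ IsSquare (b ^ 2 - δ))
    (ha : a = δ * b ^ 2 / (δ - b ^ 2)) : Interior (planeMat δ a b 1) := by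
  have hm : δ - b ^ 2 ≠ 0 := by
    intro h
    rw [← neg_sub, h] at hsq
    simp at hsq
  obtain ⟨A, hA, h⟩ := planeMat_one_congr one_ne_zero hm ((eq_div_iff hm).1 ha)
  refine ⟨A, b ^ 2 - δ, hA, hsq, ?_⟩
  simpa using h

theorem rank_smul_of_ne_zero {t : F} (ht : t ≠ 0) (M : Matrix (Fin 3) (Fin 3) F) :
    (t • M).rank = M.rank :=
  rank_smul_of_mem_nonZeroDivisors M (mem_nonZeroDivisors_of_ne_zero ht)

section
variable [Fintype F]

theorem ptsWith_plane_rank_one {δ : F} (hδ : δ ≠ 0) :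
    ptsWith F {M | ∃ a b c, M = planeMat δ a b c} (fun M => M.rank = 1) = 1 := by
  rw [ptsWith_plane δ (fun n t ht h => by rwa [rank_smul_of_ne_zero ht] at h)]
  simp [rank_planeMat_eq_one_iff hδ]

open Classical in
theorem ptsWith_plane_exterior (h2 : (2 : F) ≠ 0) {δ : F} (hδ : δ ≠ 0) :
    ptsWith F {M | ∃ a b c, M = planeMat δ a b c} Exterior =
      1 + Fintype.card {b : F // b ^ 2 ≠ δ ∧ IsSquare (b ^ 2 - δ)} := by
  have key (n) (t : F) (ht : t ≠ 0) (h : Exterior (t • planePt δ n)) :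
      Exterior (planePt δ n) := by
    have := exterior_of_smul_planePt hδ ht h
    rcases n with _ | a | ⟨b, a⟩
    · exact this.elim
    · obtain rfl : a = 0 := this
      exact exterior_planeMat_zero_one_zero h2 δ
    · exact exterior_planeMat_one this.1 this.2.1 this.2.2
  have h₁ : ¬ Exterior (planeMat δ 1 0 0) := fun h =>
    exterior_of_smul_planePt hδ one_ne_zero (n := .inl ()) (by simpa [planePt] using h)
  have h₂ (a) : Exterior (planeMat δ a 1 0) ↔ a = 0 :=
    ⟨fun h => exterior_of_smul_planePt hδ one_ne_zero (n := .inr (.inl a))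
      (by simpa [planePt] using h), fun h => h ▸ exterior_planeMat_zero_one_zero h2 δ⟩
  have h₃ (b a) : Exterior (planeMat δ a b 1) ↔
      b ^ 2 ≠ δ ∧ IsSquare (b ^ 2 - δ) ∧ a = δ * b ^ 2 / (δ - b ^ 2) :=
    ⟨fun h => exterior_of_smul_planePt hδ one_ne_zero (n := .inr (.inr (b, a)))
      (by simpa [planePt] using h), fun h => exterior_planeMat_one h.1 h.2.1 h.2.2⟩
  rw [ptsWith_plane δ key, Fintype.card_subtype, Finset.card_filter]
  simp only [h₁, h₂, h₃, ← and_assoc, ite_and, Finset.sum_ite_eq', Finset.sum_ite_irrel]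
  simp

open Classical in
theorem ptsWith_plane_interior {δ : F} (hδ : δ ≠ 0) :
    ptsWith F {M | ∃ a b c, M = planeMat δ a b c} Interior =
      Fintype.card {b : F // ¬ IsSquare (b ^ 2 - δ)} := by
  have key (n) (t : F) (ht : t ≠ 0) (h : Interior (t • planePt δ n)) :
      Interior (planePt δ n) := by
    have := interior_of_smul_planePt hδ ht h
    rcases n with _ | a | ⟨b, a⟩
    · exact this.elim
    · exact this.elim
    · exact interior_planeMat_one this.1 this.2
  have h₁ : ¬ Interior (planeMat δ 1 0 0) := fun h =>
    interior_of_smul_planePt hδ one_ne_zero (n := .inl ()) (by simpa [planePt] using h)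
  have h₂ (a) : ¬ Interior (planeMat δ a 1 0) := fun h =>
    interior_of_smul_planePt hδ one_ne_zero (n := .inr (.inl a)) (by simpa [planePt] using h)
  have h₃ (b a) : Interior (planeMat δ a b 1) ↔
      ¬ IsSquare (b ^ 2 - δ) ∧ a = δ * b ^ 2 / (δ - b ^ 2) :=
    ⟨fun h => interior_of_smul_planePt hδ one_ne_zero (n := .inr (.inr (b, a)))
      (by simpa [planePt] using h), fun h => interior_planeMat_one h.1 h.2⟩
  rw [ptsWith_plane δ key, Fintype.card_subtype, Finset.card_filter]
  simp only [h₁, h₂, h₃, ite_and, Finset.sum_ite_irrel]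
  simp

theorem sum_ite_ne_add_one [DecidableEq F] (c : F) :
    (∑ a : F, if a ≠ c then 1 else 0) + 1 = Fintype.card F := by
  rw [← Finset.card_filter, Finset.filter_ne', Finset.card_erase_of_mem (Finset.mem_univ c),
    Finset.card_univ, Nat.sub_add_cancel Fintype.card_pos]

open Classical in
theorem ptsWith_plane_rank_three {δ : F} (hδ : δ ≠ 0) :
    ptsWith F {M | ∃ a b c, M = planeMat δ a b c} (fun M => M.rank = 3) +
      Fintype.card {b : F // b ^ 2 ≠ δ} + 1 = Fintype.card F + Fintype.card F ^ 2 := by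
  rw [ptsWith_plane δ (fun n t ht h => by rwa [rank_smul_of_ne_zero ht] at h),
    Fintype.card_subtype, Finset.card_filter]
  simp only [rank_eq_three_iff, det_planeMat]
  have h₂ : (∑ a : F, if a * (δ * 0 ^ 2 - 1 ^ 2) - δ * 1 ^ 2 * 0 ≠ 0 then 1 else 0) + 1 =
      Fintype.card F := by
    simpa using sum_ite_ne_add_one (0 : F)
  have h₃ (b : F) : (∑ a : F, if a * (δ * 1 ^ 2 - b ^ 2) - δ * b ^ 2 * 1 ≠ 0 then 1 else 0) +
      (if b ^ 2 ≠ δ then 1 else 0) = Fintype.card F := by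
    by_cases hb : b ^ 2 = δ
    · simp [hb, hδ]
    · have (a : F) : a * (δ * 1 ^ 2 - b ^ 2) - δ * b ^ 2 * 1 ≠ 0 ↔
          a ≠ δ * b ^ 2 / (δ - b ^ 2) := by
        rw [Ne, Ne, eq_div_iff (sub_ne_zero.2 (Ne.symm hb)), sub_eq_zero]
        simp
      simp only [this]
      rw [if_pos hb, sum_ite_ne_add_one]
  have h₄ := Finset.sum_congr (rfl : (Finset.univ : Finset F) = _) fun b _ => h₃ b
  rw [Finset.sum_add_distrib, Finset.sum_const, Finset.card_univ, smul_eq_mul, ← sq] at h₄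
  simp only [ne_eq] at h₂ h₄ ⊢
  rw [if_neg (by simp)]
  omega

theorem card_sq_sub_sq (h2 : (2 : F) ≠ 0) {δ : F} (hδ : δ ≠ 0) :
    Nat.card {p : F × F // p.2 ^ 2 = p.1 ^ 2 - δ} = Fintype.card F - 1 := by
  classical
  rw [← Fintype.card_units, ← Nat.card_eq_fintype_card]
  have sq_eq (u : Fˣ) : ((u - δ / u) / 2 : F) ^ 2 = ((u + δ / u) / 2) ^ 2 - δ := by
    have := u.ne_zero
    field_simp
    ring
  have fst_add_snd_ne_zero (p : {p : F × F // p.2 ^ 2 = p.1 ^ 2 - δ}) : p.1.1 + p.1.2 ≠ 0 := by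
    intro h
    apply hδ
    linear_combination (p.1.1 - p.1.2) * h + p.2
  refine (Nat.card_congr
    { toFun := fun u : Fˣ => ⟨((u + δ / u) / 2, (u - δ / u) / 2), sq_eq u⟩
      invFun := fun p => Units.mk0 (p.1.1 + p.1.2) (fst_add_snd_ne_zero p)
      left_inv := fun u => ?_
      right_inv := fun p => ?_ }).symm
  · ext
    simp only [Units.val_mk0]
    field_simp
    ring
  · obtain ⟨⟨b, s⟩, h⟩ := p
    have hbs : b + s ≠ 0 := fst_add_snd_ne_zero ⟨(b, s), h⟩
    have hd : δ / (b + s) = b - s := by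
      simp only at h
      field_simp
      linear_combination h
    simp only [Units.val_mk0, hd, Subtype.mk.injEq, Prod.mk.injEq]
    constructor <;> field_simp <;> ring

open Classical in
theorem card_sq_eq (h2 : (2 : F) ≠ 0) (d : F) :
    Fintype.card {s : F // s ^ 2 = d} =
      (if d = 0 then 1 else 0) + 2 * if d ≠ 0 ∧ IsSquare d then 1 else 0 := by
  have hF : ringChar F ≠ 2 := by
    intro h
    apply h2
    have := ringChar.Nat.cast_ringChar (R := F)
    rw [h] at this
    exact_mod_cast this
  have h := quadraticChar_card_sqrts hF d
  have h' : Fintype.card {s : F // s ^ 2 = d} = {s : F | s ^ 2 = d}.toFinset.card := by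
    rw [Set.toFinset_card]; rfl
  rw [← h', quadraticChar_apply, quadraticCharFun] at h
  by_cases h0 : d = 0
  · simp_all
  · by_cases hs : IsSquare d <;> simp [h0, hs] at h ⊢ <;> omega

open Classical in
theorem card_sq_add_two_mul_card_isSquare (h2 : (2 : F) ≠ 0) {δ : F} (hδ : δ ≠ 0) :
    Fintype.card {b : F // b ^ 2 = δ} +
      2 * Fintype.card {b : F // b ^ 2 ≠ δ ∧ IsSquare (b ^ 2 - δ)} = Fintype.card F - 1 := by
  rw [← card_sq_sub_sq h2 hδ, Nat.card_eq_fintype_card]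
  simp only [Fintype.card_subtype, Finset.card_filter, Fintype.sum_prod_type]
  rw [Finset.mul_sum, ← Finset.sum_add_distrib]
  refine Finset.sum_congr rfl fun b _ => ?_
  have := card_sq_eq h2 (b ^ 2 - δ)
  rw [Fintype.card_subtype, Finset.card_filter] at this
  rw [this]
  simp [sub_eq_zero]

open Classical in
/-- The distribution of a plane, in terms of the number `z` of square roots of `δ`. -/
theorem hasPointOrbitDistribution_plane (h2 : (2 : F) ≠ 0) {δ : F} (hδ : δ ≠ 0) {z : ℕ}
    (hz : Fintype.card {b : F // b ^ 2 = δ} = z) :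
    HasPointOrbitDistribution F {M | ∃ a b c, M = planeMat δ a b c} 1
      ((Fintype.card F + 1 - z) / 2) ((Fintype.card F + 1 - z) / 2)
      (Fintype.card F ^ 2 + z - 1) := by
  have hE := card_sq_add_two_mul_card_isSquare h2 hδ
  have hq : 1 < Fintype.card F := Fintype.one_lt_card
  have hN := Fintype.card_subtype_compl fun b : F => b ^ 2 = δ
  have hle := Fintype.card_subtype_le fun b : F => b ^ 2 = δ
  have h3 := ptsWith_plane_rank_three hδ
  have hI : Fintype.card {b : F // ¬ IsSquare (b ^ 2 - δ)} +
      Fintype.card {b : F // b ^ 2 ≠ δ ∧ IsSquare (b ^ 2 - δ)} =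
      Fintype.card {b : F // b ^ 2 ≠ δ} := by
    simp only [Fintype.card_subtype, Finset.card_filter]
    rw [← Finset.sum_add_distrib]
    refine Finset.sum_congr rfl fun b _ => ?_
    by_cases hb : b ^ 2 = δ
    · simp [hb]
    · by_cases hs : IsSquare (b ^ 2 - δ) <;> simp [hb, hs]
  refine ⟨ptsWith_plane_rank_one hδ, ?_, ?_, ?_⟩
  · rw [ptsWith_plane_exterior h2 hδ]
    omega
  · rw [ptsWith_plane_interior hδ]
    simp only [ne_eq] at *
    omega
  · simp only [ne_eq] at *
    have : 0 < Fintype.card F ^ 2 := by positivity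
    omega

end

end

/-- The plane `Σ₁₂` representative has point-orbit distribution
`[1, (q−1)/2, (q−1)/2, q²+1]` and the plane `Σ₁₃` representative has point-orbit
distribution `[1, (q+1)/2, (q+1)/2, q²−1]`. -/
theorem distribution_Sigma12_Sigma13 (F : Type*) [Field F] [Fintype F]
    (hodd : Odd (Fintype.card F)) (ε : F) (hε : ¬ IsSquare ε) :
    HasPointOrbitDistribution F
      {M | ∃ a b c : F, M = !![a, b, 0; b, c, b; 0, b, c]}
      1
      ((Fintype.card F - 1) / 2)
      ((Fintype.card F - 1) / 2)
      (Fintype.card F ^ 2 + 1) ∧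
    HasPointOrbitDistribution F
      {M | ∃ a b c : F, M = !![a, b, 0; b, c, b; 0, b, ε * c]}
      1
      ((Fintype.card F + 1) / 2)
      ((Fintype.card F + 1) / 2)
      (Fintype.card F ^ 2 - 1) := by
  have h2 : (2 : F) ≠ 0 := by
    intro h
    have hchar : ringChar F = 2 := ((Nat.dvd_prime Nat.prime_two).1 (ringChar.dvd
      (by exact_mod_cast h))).resolve_left CharP.ringChar_ne_one
    have heven := FiniteField.even_card_iff_char_two.1 hchar
    rw [Nat.odd_iff] at hodd
    omega
  have hε0 : ε ≠ 0 := by rintro rfl; simp at hε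
  have hq : 1 < Fintype.card F := Fintype.one_lt_card
  classical
  have hz₁ : Fintype.card {b : F // b ^ 2 = 1} = 2 := by
    rw [card_sq_eq h2]; simp
  have hzε : Fintype.card {b : F // b ^ 2 = ε} = 0 := by
    rw [card_sq_eq h2]; simp [hε0, hε]
  have hd₁ := hasPointOrbitDistribution_plane h2 one_ne_zero hz₁
  have hdε := hasPointOrbitDistribution_plane h2 hε0 hzε
  simp only [planeMat, one_mul] at hd₁ hdε
  exact ⟨hd₁, hdε⟩
end

section
/- Let q be an odd prime power and F = F_q. The subspace W₁₅ = {[[a,b,c],[b,c,0],[c,0,0]] : a,b,c ∈ F} of Sym₃(F) (a representative of the orbit Σ₁₅) has point-orbit distribution [1, q, 0, q²]; moreover all matrices of rank at most 2 in W₁₅ lie in the 2-dimensional subspace of W₁₅ consisting of the matrices with c = 0. -/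
open Matrix

/-- If every nonzero matrix of `S` satisfying `P` is a nonzero multiple of exactly one matrix of
a family `f`, normalized by `φ (f i) = 1`, then the points counted by `ptsWith` are indexed by
the family. -/
theorem ptsWith_eq_natCard {F ι : Type*} [Field F] {S : Set (Matrix (Fin 3) (Fin 3) F)}
    {P : Matrix (Fin 3) (Fin 3) F → Prop} (hS : ∀ (c : F), ∀ M ∈ S, c • M ∈ S)
    (f : ι → Matrix (Fin 3) (Fin 3) F) (hf : Function.Injective f)
    (φ : Matrix (Fin 3) (Fin 3) F →ₗ[F] F) (hφ : ∀ i, φ (f i) = 1)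
    (hfS : ∀ i, f i ∈ S) (hfP : ∀ i, P (f i))
    (hP : ∀ M ∈ S, M ≠ 0 → P M → ∃ c : F, c ≠ 0 ∧ ∃ i, M = c • f i) :
    ptsWith F S P = Nat.card ι := by
  have hf0 : ∀ i, f i ≠ 0 := fun i h => by simpa [h] using hφ i
  have hinj : Function.Injective fun i => Submodule.span F {f i} := by
    intro i j hij
    have hmem : f i ∈ Submodule.span F {f j} := by
      rw [← show Submodule.span F {f i} = Submodule.span F {f j} from hij]
      exact Submodule.mem_span_singleton_self _
    obtain ⟨c, hc⟩ := Submodule.mem_span_singleton.1 hmem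
    have hc1 : c = 1 := by simpa [hφ] using congrArg φ hc
    exact hf (by rw [← hc, hc1, one_smul])
  rw [ptsWith, ← Set.ncard_univ ι, ← Set.ncard_image_of_injective _ hinj]
  congr 1
  ext p
  simp only [Set.mem_ofPred_eq, Set.image_univ, Set.mem_range]
  constructor
  · rintro ⟨hpS, hp, M, hMp, hM0, hPM⟩
    obtain ⟨c, hc, i, rfl⟩ := hP M (hpS hMp) hM0 hPM
    refine ⟨i, ?_⟩
    have : Module.Finite F p := Module.finite_of_finrank_eq_succ hp
    refine Submodule.eq_of_le_of_finrank_eq ?_ ?_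
    · rw [Submodule.span_singleton_le_iff_mem]
      exact (p.smul_mem_iff hc).1 hMp
    · rw [finrank_span_singleton (hf0 i), hp]
  · rintro ⟨i, rfl⟩
    refine ⟨?_, finrank_span_singleton (hf0 i), f i, Submodule.mem_span_singleton_self _, hf0 i,
      hfP i⟩
    intro M hM
    obtain ⟨c, rfl⟩ := Submodule.mem_span_singleton.1 hM
    exact hS c _ (hfS i)

theorem rank_eq_of_isUnit_of_mul_mul_transpose_eq {F n : Type*} [Field F] [Fintype n]
    [DecidableEq n] {A M D : Matrix n n F} (hA : IsUnit A) (h : A * M * Aᵀ = D) :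
    M.rank = D.rank := by
  have hdet : IsUnit A.det := (isUnit_iff_isUnit_det A).1 hA
  rw [← h, rank_mul_eq_left_of_isUnit_det _ _ (by rwa [det_transpose]),
    rank_mul_eq_right_of_isUnit_det _ _ hdet]

theorem Exterior.rank_eq {F : Type*} [Field F] {M : Matrix (Fin 3) (Fin 3) F}
    (h : Exterior M) : M.rank = 2 := by
  classical
  obtain ⟨A, hA, hM⟩ := h
  rw [rank_eq_of_isUnit_of_mul_mul_transpose_eq hA hM, rank_diagonal, Fintype.card_subtype]
  simp [Finset.filter, Fin.univ_succ]

theorem Interior.rank_eq {F : Type*} [Field F] {M : Matrix (Fin 3) (Fin 3) F}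
    (h : Interior M) : M.rank = 2 := by
  classical
  obtain ⟨A, ε, hA, hε, hM⟩ := h
  have hε0 : ε ≠ 0 := by rintro rfl; exact hε IsSquare.zero
  rw [rank_eq_of_isUnit_of_mul_mul_transpose_eq hA hM, rank_diagonal, Fintype.card_subtype]
  simp [Finset.filter, Fin.univ_succ, hε0]

/-- The general element of the plane `Σ₁₅`. -/
def sigma15Matrix {F : Type*} [Field F] (a b c : F) : Matrix (Fin 3) (Fin 3) F :=
  !![a, b, c; b, c, 0; c, 0, 0]

section

variable {F : Type*} [Field F]

theorem smul_sigma15Matrix (r a b c : F) :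
    r • sigma15Matrix a b c = sigma15Matrix (r * a) (r * b) (r * c) := by
  simp [sigma15Matrix]

theorem rank_sigma15Matrix_of_ne_zero (a b : F) {c : F} (hc : c ≠ 0) :
    (sigma15Matrix a b c).rank = 3 := by
  have hdet : (sigma15Matrix a b c).det = -c ^ 3 := by
    simp [sigma15Matrix, det_fin_three]; ring
  have h : IsUnit (sigma15Matrix a b c) := by
    rw [isUnit_iff_isUnit_det, hdet, isUnit_iff_ne_zero]
    exact neg_ne_zero.2 (pow_ne_zero 3 hc)
  simpa using rank_of_isUnit _ h

theorem exterior_sigma15Matrix (h2 : (2 : F) ≠ 0) (a : F) {b : F} (hb : b ≠ 0) :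
    Exterior (sigma15Matrix a b 0) := by
  refine ⟨!![1, (1 - a) / (2 * b), 0; 1, -(1 + a) / (2 * b), 0; 0, 0, 1], ?_, ?_⟩
  · rw [isUnit_iff_isUnit_det, isUnit_iff_ne_zero]
    have hdet : !![1, (1 - a) / (2 * b), 0; 1, -(1 + a) / (2 * b), 0; 0, 0, 1].det = -b⁻¹ := by
      rw [det_fin_three]
      simp only [of_apply, cons_val]
      field_simp
      ring
    rw [hdet]
    exact neg_ne_zero.2 (inv_ne_zero hb)
  · ext i j
    fin_cases i <;> fin_cases j <;>
      simp [sigma15Matrix, mul_apply, Fin.sum_univ_three, diagonal, vecHead, vecTail] <;>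
      field_simp <;> ring

theorem rank_sigma15Matrix_zero_zero {a : F} (ha : a ≠ 0) :
    (sigma15Matrix a 0 0).rank = 1 := by
  classical
  have : sigma15Matrix a 0 0 = diagonal ![a, 0, 0] := by
    ext i j; fin_cases i <;> fin_cases j <;> simp [sigma15Matrix]
  rw [this, rank_diagonal, Fintype.card_subtype]
  simp [Finset.filter, Fin.univ_succ, ha]

theorem sigma15Matrix_zero : sigma15Matrix (0 : F) 0 0 = 0 := by
  ext i j; fin_cases i <;> fin_cases j <;> rfl

theorem rank_sigma15Matrix_le_one (a : F) : (sigma15Matrix a 0 0).rank ≤ 1 := by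
  by_cases ha : a = 0
  · rw [ha, sigma15Matrix_zero, rank_zero]; exact zero_le_one
  · exact (rank_sigma15Matrix_zero_zero ha).le

/-- The upper left minor of `sigma15Matrix a b 0` is `-b ^ 2`, that of a matrix congruent to
`diag(1, -ε, 0)` is `-ε` times a square. -/
theorem not_interior_sigma15Matrix (a b c : F) : ¬ Interior (sigma15Matrix a b c) := by
  intro h
  have hrank := h.rank_eq
  obtain rfl : c = 0 := by
    by_contra hc
    rw [rank_sigma15Matrix_of_ne_zero a b hc] at hrank
    omega
  have hb : b ≠ 0 := by
    rintro rfl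
    have := rank_sigma15Matrix_le_one a
    omega
  obtain ⟨A, ε, hA, hε, hM⟩ := h
  have hdet : IsUnit A.det := (isUnit_iff_isUnit_det A).1 hA
  have hdet' : IsUnit Aᵀ.det := by rwa [det_transpose]
  obtain ⟨B, hB⟩ : ∃ B : Matrix (Fin 3) (Fin 3) F,
      sigma15Matrix a b 0 = B * diagonal ![1, -ε, 0] * Bᵀ := by
    refine ⟨A⁻¹, ?_⟩
    rw [← hM, transpose_nonsing_inv, mul_assoc, mul_assoc _ Aᵀ, mul_nonsing_inv _ hdet', mul_one,
      nonsing_inv_mul_cancel_left _ _ hdet]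
  have h00 : a = B 0 0 * B 0 0 - B 0 1 * ε * B 0 1 := by
    simpa [sigma15Matrix, mul_apply, Fin.sum_univ_three, diagonal, ← sub_eq_add_neg]
      using congrFun₂ hB 0 0
  have h01 : b = B 0 0 * B 1 0 - B 0 1 * ε * B 1 1 := by
    simpa [sigma15Matrix, mul_apply, Fin.sum_univ_three, diagonal, ← sub_eq_add_neg]
      using congrFun₂ hB 0 1
  have h11 : 0 = B 1 0 * B 1 0 - B 1 1 * ε * B 1 1 := by
    simpa [sigma15Matrix, mul_apply, Fin.sum_univ_three, diagonal, ← sub_eq_add_neg]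
      using congrFun₂ hB 1 1
  by_cases h1 : B 1 1 = 0
  · have h0 : B 1 0 = 0 := by simpa [h1] using h11.symm
    exact hb (by rw [h01, h0, h1]; ring)
  · exact hε ⟨B 1 0 / B 1 1, by field_simp; linear_combination h11⟩

end

/-- The plane `Σ₁₅` representative has point-orbit distribution `[1, q, 0, q²]`; moreover
all matrices of rank at most 2 in it lie in the 2-dimensional subspace of matrices with
`c = 0`. -/
theorem distribution_Sigma15 (F : Type*) [Field F] [Fintype F]
    (hodd : Odd (Fintype.card F)) :
    HasPointOrbitDistribution F
      {M | ∃ a b c : F, M = !![a, b, c; b, c, 0; c, 0, 0]}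
      1
      (Fintype.card F)
      0
      (Fintype.card F ^ 2) ∧
    ∀ M ∈ {M : Matrix (Fin 3) (Fin 3) F | ∃ a b c : F, M = !![a, b, c; b, c, 0; c, 0, 0]},
      M.rank ≤ 2 → ∃ a b : F, M = !![a, b, 0; b, 0, 0; 0, 0, 0] := by
  have h2 : (2 : F) ≠ 0 := Ring.two_ne_zero fun h => by
    have := FiniteField.even_card_of_char_two h
    rw [Nat.odd_iff] at hodd
    omega
  have hS : ∀ (r : F), ∀ M ∈ {M : Matrix (Fin 3) (Fin 3) F |
      ∃ a b c : F, M = !![a, b, c; b, c, 0; c, 0, 0]},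
      r • M ∈ {M : Matrix (Fin 3) (Fin 3) F |
        ∃ a b c : F, M = !![a, b, c; b, c, 0; c, 0, 0]} := by
    rintro r _ ⟨a, b, c, rfl⟩
    exact ⟨_, _, _, smul_sigma15Matrix r a b c⟩
  have entry : ∀ {a b c a' b' c' : F}, sigma15Matrix a b c = sigma15Matrix a' b' c' →
      a = a' ∧ b = b' := fun h => ⟨congrFun₂ h 0 0, congrFun₂ h 0 1⟩
  refine ⟨⟨?_, ?_, ?_, ?_⟩, ?_⟩
  · rw [ptsWith_eq_natCard hS (fun _ : Unit => sigma15Matrix 1 0 0)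
      (Function.injective_of_subsingleton _) (entryLinearMap F F 0 0) (fun _ => rfl)
      (fun _ => ⟨_, _, _, rfl⟩) (fun _ => rank_sigma15Matrix_zero_zero one_ne_zero),
      Nat.card_unique]
    rintro _ ⟨a, b, c, rfl⟩ hM hrank
    change (sigma15Matrix a b c).rank = 1 at hrank
    obtain rfl : c = 0 := by
      by_contra hc
      rw [rank_sigma15Matrix_of_ne_zero a b hc] at hrank
      omega
    obtain rfl : b = 0 := by
      by_contra hb
      rw [(exterior_sigma15Matrix h2 a hb).rank_eq] at hrank
      omega
    refine ⟨a, ?_, (), ?_⟩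
    · rintro rfl
      exact hM sigma15Matrix_zero
    · rw [smul_sigma15Matrix, mul_one, mul_zero]; rfl
  · rw [ptsWith_eq_natCard hS (fun a : F => sigma15Matrix a 1 0)
      (fun _ _ h => (entry h).1) (entryLinearMap F F 0 1) (fun _ => rfl)
      (fun _ => ⟨_, _, _, rfl⟩) (fun a => exterior_sigma15Matrix h2 a one_ne_zero),
      Nat.card_eq_fintype_card]
    rintro _ ⟨a, b, c, rfl⟩ - hext
    have hrank : (sigma15Matrix a b c).rank = 2 := hext.rank_eq
    obtain rfl : c = 0 := by
      by_contra hc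
      rw [rank_sigma15Matrix_of_ne_zero a b hc] at hrank
      omega
    have hb : b ≠ 0 := by
      rintro rfl
      have := rank_sigma15Matrix_le_one a
      omega
    refine ⟨b, hb, a / b, ?_⟩
    rw [smul_sigma15Matrix, mul_div_cancel₀ _ hb, mul_one, mul_zero]; rfl
  · rw [ptsWith_eq_natCard hS (fun i : Empty => i.elim)
      (Function.injective_of_subsingleton _) 0 (fun i => i.elim) (fun i => i.elim)
      (fun i => i.elim), Nat.card_of_isEmpty]
    rintro _ ⟨a, b, c, rfl⟩ - hint
    exact absurd hint (not_interior_sigma15Matrix a b c)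
  · rw [ptsWith_eq_natCard hS (fun x : F × F => sigma15Matrix x.1 x.2 1)
      (fun _ _ h => Prod.ext (entry h).1 (entry h).2) (entryLinearMap F F 0 2) (fun _ => rfl)
      (fun _ => ⟨_, _, _, rfl⟩) (fun x => rank_sigma15Matrix_of_ne_zero _ _ one_ne_zero),
      Nat.card_prod, Nat.card_eq_fintype_card, sq]
    rintro _ ⟨a, b, c, rfl⟩ - hrank
    change (sigma15Matrix a b c).rank = 3 at hrank
    have hc : c ≠ 0 := by
      rintro rfl
      by_cases hb : b = 0
      · subst hb
        have := rank_sigma15Matrix_le_one a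
        omega
      · rw [(exterior_sigma15Matrix h2 a hb).rank_eq] at hrank
        omega
    refine ⟨c, hc, (a / c, b / c), ?_⟩
    rw [smul_sigma15Matrix, mul_div_cancel₀ _ hc, mul_div_cancel₀ _ hc, mul_one]; rfl
  · rintro _ ⟨a, b, c, rfl⟩ hrank
    change (sigma15Matrix a b c).rank ≤ 2 at hrank
    obtain rfl : c = 0 := by
      by_contra hc
      rw [rank_sigma15Matrix_of_ne_zero a b hc] at hrank
      omega
    exact ⟨a, b, rfl⟩
end
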